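/- arXiv:2405.16819 — 4 statements merged into one kernel-verified Lean document; each statement's English description precedes it below -/
import Mathlib

section
/- Fix n, n′, N = n + n′, d, J, D ≥ 2J + d + 4, η₁ > 0, λ > 0, B_x ≥ 1 and B_α > 0. Then there exists an L₁-layer Transformer, in which every attention block has 4 heads and every MLP block is trivial (W₁ = W₂ = 0), with the following property: for every input (x_1,…,x_{N+1}, y_1,…,y_n) with ‖φ(x_i)‖₂ ≤ B_x for all i, define the gradient-descent sequence α_GD^{(1)} = 0 ∈ ℝ^J and α_GD^{(l+1)} = α_GD^{(l)} − η₁(Ψ α_GD^{(l)} − ψ + λ α_GD^{(l)}), and suppose ‖α_GD^{(l)}‖₂ ≤ B_α for all l ≤ L₁. Then the Transformer maps the tokens h_i^{(1)} = [z_i, φ(x_i), 0_J, 0_{D−2J−(d+4)}] exactly (with no approximation error) to h_i^{(L₁+1)} = [z_i, φ(x_i), α_GD^{(L₁)}, 0_{D−2J−(d+4)}], for all i = 1,…,N+1. -/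
open Matrix Finset

noncomputable section

/-- The ReLU activation `σ(z) = max(z,0)`. -/
def relu (z : ℝ) : ℝ := max z 0

/-- Euclidean (`ℓ²`) norm of a vector in `ℝᵏ`. -/
def l2norm {k : ℕ} (v : Fin k → ℝ) : ℝ := Real.sqrt (∑ i, v i ^ 2)

/-- A self-attention block with `M` heads on `D`-dimensional tokens of length `N+1`. -/
def attn {D M N : ℕ} (Q K V : Fin M → Matrix (Fin D) (Fin D) ℝ)
    (h : Fin (N + 1) → Fin D → ℝ) : Fin (N + 1) → Fin D → ℝ :=
  fun i => h i + ((N : ℝ) + 1)⁻¹ •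
    ∑ j, ∑ m, relu ((Q m).mulVec (h i) ⬝ᵥ (K m).mulVec (h j)) • (V m).mulVec (h j)

/-- Composition of `L` attention-only Transformer layers (each layer's MLP block being trivial,
`W₁ = W₂ = 0`, a layer reduces to its attention block), layer `l` using matrices
`(Q l, K l, V l)`. -/
def applyAttns {D M N : ℕ} (Q K V : ℕ → Fin M → Matrix (Fin D) (Fin D) ℝ) :
    ℕ → (Fin (N + 1) → Fin D → ℝ) → (Fin (N + 1) → Fin D → ℝ)
  | 0 => id
  | l + 1 => fun h => attn (Q l) (K l) (V l) (applyAttns Q K V l h)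

/-- Token layout `[xᵢ, yᵢ, tᵢ, sᵢ, 1, a, b, 0_p]` with two `J`-blocks and `p` padding zeros. -/
def tok {d J p : ℕ} (x : Fin d → ℝ) (y t s : ℝ) (a b : Fin J → ℝ) :
    Fin (d + 4 + J + J + p) → ℝ :=
  Fin.append (Fin.append (Fin.append (Fin.append x ![y, t, s, 1]) a) b) (0 : Fin p → ℝ)

/-- The uLSIF matrix `Ψ = (1/n) Σ_{i≤n} φ(xᵢ)φ(xᵢ)⊤`, expressed via the feature values
`φx i = φ(xᵢ)`. -/
def Psi (n n' J : ℕ) (φx : Fin (n + n' + 1) → Fin J → ℝ) : Matrix (Fin J) (Fin J) ℝ :=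
  fun j j' => (n : ℝ)⁻¹ * ∑ i : Fin (n + n' + 1),
    if (i : ℕ) < n then φx i j * φx i j' else 0

/-- The uLSIF vector `ψ = (1/n′) Σ_{n<i≤N} φ(xᵢ)`. -/
def psiVec (n n' J : ℕ) (φx : Fin (n + n' + 1) → Fin J → ℝ) : Fin J → ℝ :=
  fun j => (n' : ℝ)⁻¹ * ∑ i : Fin (n + n' + 1),
    if n ≤ (i : ℕ) ∧ (i : ℕ) < n + n' then φx i j else 0

/-- The vector with scalar `z` in the `y`-coordinate, `a` and `b` in the two `J`-blocks, and zeros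
elsewhere. -/
def blockVec (d J p : ℕ) (z : ℝ) (a b : Fin J → ℝ) : Fin (d + 4 + J + J + p) → ℝ :=
  Fin.append (Fin.append (Fin.append (Fin.append (0 : Fin d → ℝ) ![z, 0, 0, 0]) a) b)
    (0 : Fin p → ℝ)

/-- The four scalar coordinates `y, t, s, 1` of a token. -/
def scalars {d J p : ℕ} (h : Fin (d + 4 + J + J + p) → ℝ) : Fin 4 → ℝ :=
  fun k => h (Fin.castAdd p (Fin.castAdd J (Fin.castAdd J (Fin.natAdd d k))))

/-- The first `J`-block of a token. -/
def fstBlock {d J p : ℕ} (h : Fin (d + 4 + J + J + p) → ℝ) : Fin J → ℝ :=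
  fun k => h (Fin.castAdd p (Fin.castAdd J (Fin.natAdd (d + 4) k)))

/-- The second `J`-block of a token. -/
def sndBlock {d J p : ℕ} (h : Fin (d + 4 + J + J + p) → ℝ) : Fin J → ℝ :=
  fun k => h (Fin.castAdd p (Fin.natAdd (d + 4 + J) k))

section TokenAlgebra

variable {d J p : ℕ}

lemma blockVec_add (z z' : ℝ) (a a' b b' : Fin J → ℝ) :
    blockVec d J p (z + z') (a + a') (b + b') = blockVec d J p z a b + blockVec d J p z' a' b' := by
  ext k
  refine Fin.addCases (fun k => ?_) (fun k => ?_) k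
  · refine Fin.addCases (fun k => ?_) (fun k => ?_) k
    · refine Fin.addCases (fun k => ?_) (fun k => ?_) k
      · refine Fin.addCases (fun k => ?_) (fun k => ?_) k
        · simp [blockVec]
        · fin_cases k <;> simp [blockVec]
      · simp [blockVec]
    · simp [blockVec]
  · simp [blockVec]

lemma blockVec_smul (c z : ℝ) (a b : Fin J → ℝ) :
    blockVec d J p (c * z) (c • a) (c • b) = c • blockVec d J p z a b := by
  ext k
  refine Fin.addCases (fun k => ?_) (fun k => ?_) k
  · refine Fin.addCases (fun k => ?_) (fun k => ?_) k
    · refine Fin.addCases (fun k => ?_) (fun k => ?_) k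
      · refine Fin.addCases (fun k => ?_) (fun k => ?_) k
        · simp [blockVec]
        · fin_cases k <;> simp [blockVec]
      · simp [blockVec]
    · simp [blockVec]
  · simp [blockVec]

lemma blockVec_dotProduct (z z' : ℝ) (a a' b b' : Fin J → ℝ) :
    blockVec d J p z a b ⬝ᵥ blockVec d J p z' a' b' = z * z' + a ⬝ᵥ a' + b ⬝ᵥ b' := by
  simp [dotProduct, blockVec, Fin.sum_univ_add, Fin.sum_univ_four]

lemma tok_add_blockVec (x : Fin d → ℝ) (y t s : ℝ) (a b v : Fin J → ℝ) :
    tok (p := p) x y t s a b + blockVec d J p 0 0 v = tok x y t s a (b + v) := by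
  ext k
  refine Fin.addCases (fun k => ?_) (fun k => ?_) k
  · refine Fin.addCases (fun k => ?_) (fun k => ?_) k
    · refine Fin.addCases (fun k => ?_) (fun k => ?_) k
      · refine Fin.addCases (fun k => ?_) (fun k => ?_) k
        · simp [blockVec, tok]
        · fin_cases k <;> simp [blockVec, tok]
      · simp [blockVec, tok]
    · simp [blockVec, tok]
  · simp [blockVec, tok]

@[simp] lemma scalars_tok (x : Fin d → ℝ) (y t s : ℝ) (a b : Fin J → ℝ) :
    scalars (tok (p := p) x y t s a b) = ![y, t, s, 1] := by
  ext k
  simp [scalars, tok]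

@[simp] lemma fstBlock_tok (x : Fin d → ℝ) (y t s : ℝ) (a b : Fin J → ℝ) :
    fstBlock (tok (p := p) x y t s a b) = a := by
  ext k
  simp [fstBlock, tok]

@[simp] lemma sndBlock_tok (x : Fin d → ℝ) (y t s : ℝ) (a b : Fin J → ℝ) :
    sndBlock (tok (p := p) x y t s a b) = b := by
  ext k
  simp [sndBlock, tok]

/-- `blockVec` in its second `J`-block, as a linear map. -/
def sndBlockEmb (d J p : ℕ) : (Fin J → ℝ) →ₗ[ℝ] (Fin (d + 4 + J + J + p) → ℝ) where
  toFun v := blockVec d J p 0 0 v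
  map_add' v w := by rw [← blockVec_add, add_zero, add_zero]
  map_smul' c v := by
    rw [RingHom.id_apply, ← blockVec_smul, mul_zero, smul_zero]

/-- The linear map sending a token with scalars `r` and blocks `a`, `b` to the vector
with scalar `w ⬝ r` and blocks `c₁ a + c₂ b`, `c₃ a + c₄ b`. -/
def blockMap (d J p : ℕ) (w : Fin 4 → ℝ) (c₁ c₂ c₃ c₄ : ℝ) :
    (Fin (d + 4 + J + J + p) → ℝ) →ₗ[ℝ] (Fin (d + 4 + J + J + p) → ℝ) where
  toFun h := blockVec d J p (w ⬝ᵥ scalars h) (c₁ • fstBlock h + c₂ • sndBlock h)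
    (c₃ • fstBlock h + c₄ • sndBlock h)
  map_add' h h' := by
    rw [← blockVec_add, ← dotProduct_add]
    congr 1 <;> ext k <;> simp [fstBlock, sndBlock] <;> ring
  map_smul' c h := by
    rw [RingHom.id_apply, ← blockVec_smul, ← smul_eq_mul c, ← dotProduct_smul]
    congr 1 <;> ext k <;> simp [fstBlock, sndBlock] <;> ring

/-- The matrix of `blockMap`. -/
def blockMat (d J p : ℕ) (w : Fin 4 → ℝ) (c₁ c₂ c₃ c₄ : ℝ) :
    Matrix (Fin (d + 4 + J + J + p)) (Fin (d + 4 + J + J + p)) ℝ :=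
  LinearMap.toMatrix' (blockMap d J p w c₁ c₂ c₃ c₄)

lemma blockMat_mulVec_tok (w : Fin 4 → ℝ) (c₁ c₂ c₃ c₄ : ℝ)
    (x : Fin d → ℝ) (y t s : ℝ) (a b : Fin J → ℝ) :
    (blockMat d J p w c₁ c₂ c₃ c₄).mulVec (tok x y t s a b) =
      blockVec d J p (w ⬝ᵥ ![y, t, s, 1]) (c₁ • a + c₂ • b) (c₃ • a + c₄ • b) := by
  rw [blockMat, LinearMap.toMatrix'_mulVec]
  simp [blockMap]

end TokenAlgebra

lemma relu_sub_relu_neg (z : ℝ) : relu z - relu (-z) = z := by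
  unfold relu
  rcases le_total z 0 with h | h
  · rw [max_eq_right h, max_eq_left (by linarith)]; ring
  · rw [max_eq_left h, max_eq_right (by linarith)]; ring

lemma relu_of_nonpos {z : ℝ} (h : z ≤ 0) : relu z = 0 := max_eq_right h

lemma abs_dotProduct_le_l2norm_mul {k : ℕ} (v w : Fin k → ℝ) :
    |v ⬝ᵥ w| ≤ l2norm v * l2norm w := by
  rw [l2norm, l2norm, ← Real.sqrt_mul (Finset.sum_nonneg fun i _ => sq_nonneg _)]
  exact Real.abs_le_sqrt (Finset.sum_mul_sq_le_sq_mul_sq _ _ _)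

/-- Query matrices for one gradient step: expose the constant `1` and the current iterate. -/
def gdQuery (d J p : ℕ) : Fin 4 → Matrix (Fin (d + 4 + J + J + p)) (Fin (d + 4 + J + J + p)) ℝ :=
  fun _ => blockMat d J p ![0, 0, 0, 1] 0 1 0 0

/-- Key matrices for one gradient step; `R` is the threshold switching off the first two heads
outside the source sample. -/
def gdKey (d J p : ℕ) (R : ℝ) :
    Fin 4 → Matrix (Fin (d + 4 + J + J + p)) (Fin (d + 4 + J + J + p)) ℝ :=
  ![blockMat d J p ![0, R, 0, -R] 1 0 0 0, blockMat d J p ![0, R, 0, -R] (-1) 0 0 0,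
    blockMat d J p ![0, -1, 1, 0] 0 0 0 0, blockMat d J p ![0, 0, 0, 1] 0 0 0 0]

/-- Value matrices for one gradient step. -/
def gdValue (n n' d J p : ℕ) (η lam : ℝ) :
    Fin 4 → Matrix (Fin (d + 4 + J + J + p)) (Fin (d + 4 + J + J + p)) ℝ :=
  ![blockMat d J p 0 0 0 (-(η * (((n + n' : ℕ) : ℝ) + 1) * (n : ℝ)⁻¹)) 0,
    blockMat d J p 0 0 0 (η * (((n + n' : ℕ) : ℝ) + 1) * (n : ℝ)⁻¹) 0,
    blockMat d J p 0 0 0 (η * (((n + n' : ℕ) : ℝ) + 1) * (n' : ℝ)⁻¹) 0,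
    blockMat d J p 0 0 0 0 (-(η * lam))]

/-- One attention block with four heads performs one exact uLSIF gradient step on the second
`J`-block. -/
lemma attn_gd_step (n n' d J p : ℕ) (η lam R : ℝ)
    (x : Fin (n + n' + 1) → Fin d → ℝ) (y : Fin (n + n' + 1) → ℝ)
    (φx : Fin (n + n' + 1) → Fin J → ℝ) (α : Fin J → ℝ) (hR : ∀ i, |α ⬝ᵥ φx i| ≤ R) :
    attn (gdQuery d J p) (gdKey d J p R) (gdValue n n' d J p η lam)
        (fun i => tok (x i) (y i) (if (i : ℕ) < n then 1 else 0)
          (if (i : ℕ) < n + n' then 1 else 0) (φx i) α) =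
      fun i => tok (x i) (y i) (if (i : ℕ) < n then 1 else 0)
        (if (i : ℕ) < n + n' then 1 else 0) (φx i)
        (α - η • ((Psi n n' J φx).mulVec α - psiVec n n' J φx + lam • α)) := by
  set c : ℝ := η * (((n + n' : ℕ) : ℝ) + 1) with hc
  have hhead : ∀ i j : Fin (n + n' + 1), ∑ m,
      relu ((gdQuery d J p m).mulVec (tok (x i) (y i) (if (i : ℕ) < n then 1 else 0)
          (if (i : ℕ) < n + n' then 1 else 0) (φx i) α) ⬝ᵥ
        (gdKey d J p R m).mulVec (tok (x j) (y j) (if (j : ℕ) < n then 1 else 0)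
          (if (j : ℕ) < n + n' then 1 else 0) (φx j) α)) •
        (gdValue n n' d J p η lam m).mulVec (tok (x j) (y j) (if (j : ℕ) < n then 1 else 0)
          (if (j : ℕ) < n + n' then 1 else 0) (φx j) α) =
      sndBlockEmb d J p (-(c * (n : ℝ)⁻¹ * if (j : ℕ) < n then α ⬝ᵥ φx j else 0) • φx j +
        (c * (n' : ℝ)⁻¹ * if n ≤ (j : ℕ) ∧ (j : ℕ) < n + n' then 1 else 0) • φx j -
        (η * lam) • α) := by
    intro i j
    have hj := abs_le.1 (hR j)
    have key : ∀ r₁ r₂ r₃ r₄ : ℝ,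
        r₁ - r₂ = (if (j : ℕ) < n then α ⬝ᵥ φx j else 0) →
        r₃ = (if n ≤ (j : ℕ) ∧ (j : ℕ) < n + n' then 1 else 0) → r₄ = 1 →
        r₁ • sndBlockEmb d J p (-(c * (n : ℝ)⁻¹) • φx j) +
          r₂ • sndBlockEmb d J p ((c * (n : ℝ)⁻¹) • φx j) +
          r₃ • sndBlockEmb d J p ((c * (n' : ℝ)⁻¹) • φx j) +
          r₄ • sndBlockEmb d J p (-(η * lam) • α) =
        sndBlockEmb d J p (-(c * (n : ℝ)⁻¹ * if (j : ℕ) < n then α ⬝ᵥ φx j else 0) • φx j +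
          (c * (n' : ℝ)⁻¹ * if n ≤ (j : ℕ) ∧ (j : ℕ) < n + n' then 1 else 0) • φx j -
          (η * lam) • α) := by
      intro r₁ r₂ r₃ r₄ h₁ h₃ h₄
      rw [← h₁, ← h₃, h₄]
      simp only [← map_smul, ← map_add]
      congr 1
      module
    rw [← key _ _ _ _ ?_ ?_ ?_, Fin.sum_univ_four]
    · simp only [gdQuery, gdKey, gdValue, blockMat_mulVec_tok, blockVec_dotProduct, sndBlockEmb,
        LinearMap.coe_mk, AddHom.coe_mk, Matrix.cons_val, zero_dotProduct, zero_smul, zero_add,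
        add_zero]
      rfl
    · by_cases h : (j : ℕ) < n
      · simpa [h] using relu_sub_relu_neg (α ⬝ᵥ φx j)
      · simp [h]
        rw [relu_of_nonpos (by linarith), relu_of_nonpos (by linarith), sub_zero]
    · by_cases h : (j : ℕ) < n
      · have h' : (j : ℕ) < n + n' := by omega
        simp [h, h', relu]
      · by_cases h' : (j : ℕ) < n + n' <;> simp [h, h', not_lt.1 h, relu]
    · simp [relu]
  funext i
  simp only [attn]
  rw [Finset.sum_congr rfl fun j _ => hhead i j, ← map_sum, ← map_smul]
  change _ + blockVec d J p 0 0 _ = _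
  rw [tok_add_blockVec]
  congr 1
  ext k
  simp only [Pi.add_apply, Pi.smul_apply, Pi.sub_apply, Finset.sum_apply, smul_eq_mul,
    Finset.sum_add_distrib, Finset.sum_sub_distrib, Finset.sum_const, Finset.card_univ,
    Fintype.card_fin]
  have hΨ : (Psi n n' J φx).mulVec α k = (n : ℝ)⁻¹ * ∑ j : Fin (n + n' + 1),
      (if (j : ℕ) < n then α ⬝ᵥ φx j else 0) * φx j k := by
    simp only [Matrix.mulVec, dotProduct, Psi, Finset.mul_sum, Finset.sum_mul]
    rw [Finset.sum_comm]
    refine Finset.sum_congr rfl fun j _ => ?_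
    split_ifs
    · rw [Finset.sum_mul, Finset.mul_sum]
      exact Finset.sum_congr rfl fun _ _ => by ring
    · simp
  have hψ : psiVec n n' J φx k = (n' : ℝ)⁻¹ * ∑ j : Fin (n + n' + 1),
      (if n ≤ (j : ℕ) ∧ (j : ℕ) < n + n' then 1 else 0) * φx j k := by
    simp only [psiVec, ite_mul, one_mul, zero_mul]
  rw [hΨ, hψ]
  simp only [nsmul_eq_mul, Nat.cast_add_one, neg_mul, Finset.sum_neg_distrib, mul_assoc,
    ← Finset.mul_sum, hc]
  field_simp
  ring

/-- **In-context gradient descent for uLSIF.**  There exists an `L₁`-layer Transformer, every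
attention block having `4` heads and every MLP block trivial, which maps the tokens
`[zᵢ, φ(xᵢ), 0_J, 0]` exactly to `[zᵢ, φ(xᵢ), α_GD^{(L₁)}, 0]`, where `α_GD^{(1)} = 0` and
`α_GD^{(l+1)} = α_GD^{(l)} − η₁(Ψ α_GD^{(l)} − ψ + λ α_GD^{(l)})`, provided
`‖φ(xᵢ)‖₂ ≤ B_x` for all `i` and `‖α_GD^{(l)}‖₂ ≤ B_α` for all `l ≤ L₁`. -/
theorem transformer_implements_ulsif_gradient_descent
    (n n' d J p L₁ : ℕ) (hn : 0 < n) (hn' : 0 < n') (hL₁ : 1 ≤ L₁)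
    (η₁ lam B_x B_α : ℝ) (hη₁ : 0 < η₁) (hlam : 0 < lam) (hBx : 1 ≤ B_x) (hBα : 0 < B_α) :
    ∃ Q K V : ℕ → Fin 4 → Matrix (Fin (d + 4 + J + J + p)) (Fin (d + 4 + J + J + p)) ℝ,
      ∀ (x : Fin (n + n' + 1) → Fin d → ℝ) (y : Fin (n + n' + 1) → ℝ)
        (φx : Fin (n + n' + 1) → Fin J → ℝ) (αGD : ℕ → Fin J → ℝ),
        (∀ i : Fin (n + n' + 1), n ≤ (i : ℕ) → y i = 0) →
        (∀ i, l2norm (φx i) ≤ B_x) →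
        αGD 1 = 0 →
        (∀ l, 1 ≤ l →
          αGD (l + 1) = αGD l - η₁ •
            ((Psi n n' J φx).mulVec (αGD l) - psiVec n n' J φx + lam • αGD l)) →
        (∀ l, 1 ≤ l → l ≤ L₁ → l2norm (αGD l) ≤ B_α) →
        (applyAttns Q K V L₁ fun i =>
            tok (x i) (y i) (if (i : ℕ) < n then 1 else 0)
              (if (i : ℕ) < n + n' then 1 else 0) (φx i) (0 : Fin J → ℝ)) =
          fun i =>
            tok (x i) (y i) (if (i : ℕ) < n then 1 else 0)
              (if (i : ℕ) < n + n' then 1 else 0) (φx i) (αGD L₁) := by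
  have hR : ∀ v w : Fin J → ℝ, l2norm v ≤ B_α → l2norm w ≤ B_x → |v ⬝ᵥ w| ≤ B_α * B_x :=
    fun v w hv hw => (abs_dotProduct_le_l2norm_mul v w).trans
      (mul_le_mul hv hw (Real.sqrt_nonneg _) hBα.le)
  refine ⟨fun _ => gdQuery d J p, fun _ => gdKey d J p (B_α * B_x),
    fun l => if l = 0 then 0 else gdValue n n' d J p η₁ lam, ?_⟩
  intro x y φx αGD _ hφ h1 hstep hα
  induction L₁, hL₁ using Nat.le_induction with
  | base =>
    funext i
    simp [applyAttns, attn, h1]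
  | succ l hl ih =>
    simp only [applyAttns]
    rw [ih fun k hk hkl => hα k hk (by omega), if_neg (by omega), attn_gd_step _ _ _ _ _ _ _ _ _ _ _ _
      fun i => hR _ _ (hα l hl (by omega)) (hφ i), ← hstep l hl]
end
end

section
/- Fix B_u, B_w, B_v, B_x > 0, K ∈ ℕ, ε_r > 0, and R₁ ≥ B_u B_x. Suppose the activation r: ℝ → ℝ is (ε_r, R₁, M₁, C₁)-approximable by sum of ReLUs, with approximant r̄(t) = Σ_{m=1}^{M₁} c_m σ(a_m t + b_m). Then there exists an attention block with K·M₁ heads such that for every input with ‖x_i‖₂ ≤ B_x and every (w, v, u) ∈ 𝒲, it maps the tokens h_i = [z_i, u, w, v, 0_4] to h′_i = [z_i, u, w, v, Λ̄(x_i), Δ̄(x_i), 0_2] for all i = 1,…,N+1, where Λ̄(x) = Σ_{k=1}^K w_k r̄(u_k^⊤ x) and Δ̄(x) = Σ_{k=1}^K v_k r̄(u_k^⊤ x); consequently |Λ̄(x_i) − Λ(x_i; u, w)| ≤ ‖w‖₁ ε_r ≤ √K B_w ε_r and |Δ̄(x_i) − Δ(x_i; u, v)| ≤ ‖v‖₁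 ε_r ≤ √K B_v ε_r for all i. -/
open Matrix Finset

noncomputable section

/-- Euclidean norm of a `K × d` array (the flattened vector `vec(U)`). -/
def l2norm2 {K d : ℕ} (u : Fin K → Fin d → ℝ) : ℝ := Real.sqrt (∑ k, ∑ j, u k j ^ 2)

/-- An MLP block `h ↦ h + W₂ σ(W₁ h)`, applied to one token. -/
def mlp {D D' : ℕ} (W₁ : Matrix (Fin D') (Fin D) ℝ) (W₂ : Matrix (Fin D) (Fin D') ℝ)
    (h : Fin D → ℝ) : Fin D → ℝ :=
  h + W₂.mulVec fun k => relu (W₁.mulVec h k)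

/-- A Transformer layer (attention block with some number `M` of heads, then an MLP block). -/
structure TLayer (D : ℕ) where
  M : ℕ
  Q : Fin M → Matrix (Fin D) (Fin D) ℝ
  K : Fin M → Matrix (Fin D) (Fin D) ℝ
  V : Fin M → Matrix (Fin D) (Fin D) ℝ
  D' : ℕ
  W₁ : Matrix (Fin D') (Fin D) ℝ
  W₂ : Matrix (Fin D) (Fin D') ℝ

/-- Apply a Transformer layer to a token sequence. -/
def TLayer.apply {D : ℕ} (T : TLayer D) {N : ℕ}
    (h : Fin (N + 1) → Fin D → ℝ) : Fin (N + 1) → Fin D → ℝ :=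
  fun i => mlp T.W₁ T.W₂ (attn T.Q T.K T.V h i)

/-- Two-layer network `Λ(x; u, w) = Σ_k w_k r(u_k⊤x)` (also `Δ(x; u, v) = Σ_k v_k r(u_k⊤x)`). -/
def net {K d : ℕ} (r : ℝ → ℝ) (u : Fin K → Fin d → ℝ) (w : Fin K → ℝ) (x : Fin d → ℝ) : ℝ :=
  ∑ k, w k * r (u k ⬝ᵥ x)

/-- Sigmoid cross entropy `γ(p,q) = −q log p − (1−q) log(1−p)`. -/
def xent (p q : ℝ) : ℝ := -q * Real.log p - (1 - q) * Real.log (1 - p)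

/-- Its partial derivative `∂₁γ(p,q) = −q/p + (1−q)/(1−p)`. -/
def dxent (p q : ℝ) : ℝ := -q / p + (1 - q) / (1 - p)

/-- The DANN label-classification loss `L(u,w) = (1/n) Σ_{i≤n} γ(Λ(xᵢ; u, w), yᵢ)`. -/
def labelLoss (n n' d K : ℕ) (r : ℝ → ℝ) (x : Fin (n + n' + 1) → Fin d → ℝ)
    (y : Fin (n + n' + 1) → ℝ) (u : Fin K → Fin d → ℝ) (w : Fin K → ℝ) : ℝ :=
  (n : ℝ)⁻¹ * ∑ i : Fin (n + n' + 1),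
    if (i : ℕ) < n then xent (net r u w (x i)) (y i) else 0

/-- The DANN domain-classification loss
`Ω(u,v) = (1/n) Σ_{i≤n} γ(Δ(xᵢ), 0) + (1/n′) Σ_{n<i≤N} γ(Δ(xᵢ), 1)`. -/
def domainLoss (n n' d K : ℕ) (r : ℝ → ℝ) (x : Fin (n + n' + 1) → Fin d → ℝ)
    (u : Fin K → Fin d → ℝ) (v : Fin K → ℝ) : ℝ :=
  (n : ℝ)⁻¹ * (∑ i : Fin (n + n' + 1),
      if (i : ℕ) < n then xent (net r u v (x i)) 0 else 0)
    + (n' : ℝ)⁻¹ * ∑ i : Fin (n + n' + 1),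
      if n ≤ (i : ℕ) ∧ (i : ℕ) < n + n' then xent (net r u v (x i)) 1 else 0

/-- `∇_w L(u,w)`, with `(∇_w L)_k = (1/n) Σ_{i≤n} ∂₁γ(Λ(xᵢ), yᵢ) r(u_k⊤xᵢ)`. -/
def gradW_label (n n' d K : ℕ) (r : ℝ → ℝ) (x : Fin (n + n' + 1) → Fin d → ℝ)
    (y : Fin (n + n' + 1) → ℝ) (u : Fin K → Fin d → ℝ) (w : Fin K → ℝ) : Fin K → ℝ :=
  fun k => (n : ℝ)⁻¹ * ∑ i : Fin (n + n' + 1),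
    if (i : ℕ) < n then dxent (net r u w (x i)) (y i) * r (u k ⬝ᵥ x i) else 0

/-- `∇_u L(u,w)`, with `∇_{u_k} L = (1/n) Σ_{i≤n} ∂₁γ(Λ(xᵢ), yᵢ) w_k r′(u_k⊤xᵢ) xᵢ`. -/
def gradU_label (n n' d K : ℕ) (r : ℝ → ℝ) (x : Fin (n + n' + 1) → Fin d → ℝ)
    (y : Fin (n + n' + 1) → ℝ) (u : Fin K → Fin d → ℝ) (w : Fin K → ℝ) :
    Fin K → Fin d → ℝ :=
  fun k j => (n : ℝ)⁻¹ * ∑ i : Fin (n + n' + 1),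
    if (i : ℕ) < n then
      dxent (net r u w (x i)) (y i) * w k * deriv r (u k ⬝ᵥ x i) * x i j else 0

/-- `∇_v Ω(u,v)`. -/
def gradV_domain (n n' d K : ℕ) (r : ℝ → ℝ) (x : Fin (n + n' + 1) → Fin d → ℝ)
    (u : Fin K → Fin d → ℝ) (v : Fin K → ℝ) : Fin K → ℝ :=
  fun k => (n : ℝ)⁻¹ * (∑ i : Fin (n + n' + 1),
      if (i : ℕ) < n then dxent (net r u v (x i)) 0 * r (u k ⬝ᵥ x i) else 0)
    + (n' : ℝ)⁻¹ * ∑ i : Fin (n + n' + 1),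
      if n ≤ (i : ℕ) ∧ (i : ℕ) < n + n' then dxent (net r u v (x i)) 1 * r (u k ⬝ᵥ x i) else 0

/-- `∇_u Ω(u,v)`. -/
def gradU_domain (n n' d K : ℕ) (r : ℝ → ℝ) (x : Fin (n + n' + 1) → Fin d → ℝ)
    (u : Fin K → Fin d → ℝ) (v : Fin K → ℝ) : Fin K → Fin d → ℝ :=
  fun k j => (n : ℝ)⁻¹ * (∑ i : Fin (n + n' + 1),
      if (i : ℕ) < n then
        dxent (net r u v (x i)) 0 * v k * deriv r (u k ⬝ᵥ x i) * x i j else 0)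
    + (n' : ℝ)⁻¹ * ∑ i : Fin (n + n' + 1),
      if n ≤ (i : ℕ) ∧ (i : ℕ) < n + n' then
        dxent (net r u v (x i)) 1 * v k * deriv r (u k ⬝ᵥ x i) * x i j else 0

/-- The constraint set `𝒲 = {(w,v,u) : ‖w‖₂ ≤ B_w, ‖v‖₂ ≤ B_v, max_k ‖u_k‖₂ ≤ B_u}`. -/
def memW {K d : ℕ} (B_w B_v B_u : ℝ) (w v : Fin K → ℝ) (u : Fin K → Fin d → ℝ) : Prop :=
  l2norm w ≤ B_w ∧ l2norm v ≤ B_v ∧ ∀ k, l2norm (u k) ≤ B_u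

/-- Euclidean projection onto the centered ball of radius `B`. -/
def projBall {k : ℕ} (B : ℝ) (v : Fin k → ℝ) : Fin k → ℝ :=
  if l2norm v ≤ B then v else (B / l2norm v) • v

/-- Flattening `vec(U)` of `U ∈ ℝ^{K×d}` into `ℝ^{Kd}`. -/
def flat {K d : ℕ} (u : Fin K → Fin d → ℝ) : Fin (K * d) → ℝ :=
  fun i => u (finProdFinEquiv.symm i).1 (finProdFinEquiv.symm i).2

/-- Token layout `[xᵢ, yᵢ, tᵢ, sᵢ, 1, vec(U), w, v, e]` with a final block `e ∈ ℝ⁴` of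
scratch coordinates. -/
def tokD {d K : ℕ} (x : Fin d → ℝ) (y t s : ℝ) (u : Fin K → Fin d → ℝ) (w v : Fin K → ℝ)
    (e : Fin 4 → ℝ) : Fin (d + 4 + K * d + K + K + 4) → ℝ :=
  Fin.append (Fin.append (Fin.append (Fin.append (Fin.append x ![y, t, s, 1]) (flat u)) w) v) e

/-- Coordinate of a token holding the `p`-th entry of `x`. -/
def idxX (d K : ℕ) (p : Fin d) : Fin (d + 4 + K * d + K + K + 4) :=
  (((((p.castAdd 4).castAdd (K * d)).castAdd K).castAdd K).castAdd 4)

/-- Coordinate of a token holding the constant `1`. -/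
def idxOne (d K : ℕ) : Fin (d + 4 + K * d + K + K + 4) :=
  (((((Fin.natAdd d (3 : Fin 4)).castAdd (K * d)).castAdd K).castAdd K).castAdd 4)

/-- Coordinate of a token holding `u k p`. -/
def idxU (d K : ℕ) (k : Fin K) (p : Fin d) : Fin (d + 4 + K * d + K + K + 4) :=
  (((Fin.natAdd (d + 4) (finProdFinEquiv (k, p))).castAdd K).castAdd K).castAdd 4

/-- Coordinate of a token holding `w k`. -/
def idxW (d K : ℕ) (k : Fin K) : Fin (d + 4 + K * d + K + K + 4) :=
  ((Fin.natAdd (d + 4 + K * d) k).castAdd K).castAdd 4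

/-- Coordinate of a token holding `v k`. -/
def idxV (d K : ℕ) (k : Fin K) : Fin (d + 4 + K * d + K + K + 4) :=
  (Fin.natAdd (d + 4 + K * d + K) k).castAdd 4

/-- Coordinate of a token holding the `l`-th scratch entry. -/
def idxE (d K : ℕ) (l : Fin 4) : Fin (d + 4 + K * d + K + K + 4) :=
  Fin.natAdd (d + 4 + K * d + K + K) l

section tokD

variable {d K : ℕ} (x : Fin d → ℝ) (y t s : ℝ) (u : Fin K → Fin d → ℝ) (w v : Fin K → ℝ)
  (e : Fin 4 → ℝ)

lemma tokD_idxX (p : Fin d) : tokD x y t s u w v e (idxX d K p) = x p := by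
  simp only [tokD, idxX, Fin.append_left]

lemma tokD_idxOne : tokD x y t s u w v e (idxOne d K) = 1 := by
  simp only [tokD, idxOne, Fin.append_left, Fin.append_right]
  rfl

lemma tokD_idxU (k : Fin K) (p : Fin d) : tokD x y t s u w v e (idxU d K k p) = u k p := by
  simp only [tokD, idxU, Fin.append_left, Fin.append_right, flat, Equiv.symm_apply_apply]

lemma tokD_idxW (k : Fin K) : tokD x y t s u w v e (idxW d K k) = w k := by
  simp only [tokD, idxW, Fin.append_left, Fin.append_right]

lemma tokD_idxV (k : Fin K) : tokD x y t s u w v e (idxV d K k) = v k := by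
  simp only [tokD, idxV, Fin.append_left, Fin.append_right]

/-- Writing two values into the empty scratch block of a token. -/
lemma tokD_zero_add_single (α β : ℝ) :
    tokD x y t s u w v 0 + (Pi.single (idxE d K 0) α + Pi.single (idxE d K 1) β) =
      tokD x y t s u w v ![α, β, 0, 0] := by
  funext q
  induction q using Fin.addCases with
  | left q =>
    have h : ∀ l, Fin.castAdd 4 q ≠ idxE d K l := by
      intro l hl
      have := congrArg Fin.val hl
      simp only [idxE, Fin.val_castAdd, Fin.val_natAdd] at this
      omega
    simp [tokD, h]
  | right l =>
    have h : ∀ l', (Fin.natAdd (d + 4 + K * d + K + K) l = idxE d K l') ↔ l = l' := by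
      intro l'
      simp [idxE]
    simp only [tokD, Pi.add_apply, Fin.append_right, Pi.single_apply, h]
    fin_cases l <;> simp

end tokD

lemma idxX_injective (d K : ℕ) : Function.Injective (idxX d K) := by
  intro p q h
  have := congrArg Fin.val h
  simp only [idxX, Fin.val_castAdd] at this
  exact Fin.ext this

lemma idxX_ne_idxOne (d K : ℕ) (p : Fin d) : idxX d K p ≠ idxOne d K := by
  intro h
  have := congrArg Fin.val h
  simp only [idxX, idxOne, Fin.val_castAdd, Fin.val_natAdd] at this
  omega

/-- Query matrix sending a token to `a x` in the `x` block and `b` in the constant slot. -/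
def forwardQuery (d K : ℕ) (a b : ℝ) :
    Matrix (Fin (d + 4 + K * d + K + K + 4)) (Fin (d + 4 + K * d + K + K + 4)) ℝ :=
  ∑ p, Matrix.single (idxX d K p) (idxX d K p) a + Matrix.single (idxOne d K) (idxOne d K) b

/-- Key matrix sending a token to `u k` in the `x` block and `1` in the constant slot. -/
def forwardKey (d K : ℕ) (k : Fin K) :
    Matrix (Fin (d + 4 + K * d + K + K + 4)) (Fin (d + 4 + K * d + K + K + 4)) ℝ :=
  ∑ p, Matrix.single (idxX d K p) (idxU d K k p) 1 + Matrix.single (idxOne d K) (idxOne d K) 1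

/-- Value matrix writing `c * w k` and `c * v k` into the first two scratch slots. -/
def forwardValue (d K : ℕ) (k : Fin K) (c : ℝ) :
    Matrix (Fin (d + 4 + K * d + K + K + 4)) (Fin (d + 4 + K * d + K + K + 4)) ℝ :=
  Matrix.single (idxE d K 0) (idxW d K k) c + Matrix.single (idxE d K 1) (idxV d K k) c

lemma single_mulVec_eq_piSingle {ι : Type*} [Fintype ι] [DecidableEq ι] (i j : ι) (a : ℝ)
    (h : ι → ℝ) : (Matrix.single i j a).mulVec h = Pi.single i (a * h j) := by
  rw [Matrix.single_mulVec]
  rfl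

lemma forwardQuery_dotProduct_forwardKey {d K : ℕ} (a b : ℝ) (k : Fin K)
    (x x' : Fin d → ℝ) (y t s y' t' s' : ℝ) (u u' : Fin K → Fin d → ℝ) (w v w' v' : Fin K → ℝ)
    (e e' : Fin 4 → ℝ) :
    (forwardQuery d K a b).mulVec (tokD x y t s u w v e) ⬝ᵥ
        (forwardKey d K k).mulVec (tokD x' y' t' s' u' w' v' e') =
      a * (u' k ⬝ᵥ x) + b := by
  have key_X : ∀ p, (forwardKey d K k).mulVec (tokD x' y' t' s' u' w' v' e') (idxX d K p) =
      u' k p := by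
    intro p
    simp [forwardKey, Matrix.add_mulVec, Matrix.sum_mulVec, single_mulVec_eq_piSingle,
      tokD_idxU, Finset.sum_apply, Pi.single_apply, (idxX_injective d K).eq_iff,
      idxX_ne_idxOne]
  have key_one : (forwardKey d K k).mulVec (tokD x' y' t' s' u' w' v' e') (idxOne d K) = 1 := by
    simp [forwardKey, Matrix.add_mulVec, Matrix.sum_mulVec, single_mulVec_eq_piSingle,
      tokD_idxOne, Finset.sum_apply, (idxX_ne_idxOne _ _ _).symm]
  simp only [forwardQuery, Matrix.add_mulVec, Matrix.sum_mulVec, single_mulVec_eq_piSingle,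
    add_dotProduct, sum_dotProduct, single_dotProduct, key_X, key_one, tokD_idxX, tokD_idxOne,
    mul_one]
  rw [dotProduct, Finset.mul_sum]
  congr 1
  exact Finset.sum_congr rfl fun p _ => by ring

lemma forwardValue_mulVec {d K : ℕ} (k : Fin K) (c : ℝ) (x : Fin d → ℝ) (y t s : ℝ)
    (u : Fin K → Fin d → ℝ) (w v : Fin K → ℝ) (e : Fin 4 → ℝ) :
    (forwardValue d K k c).mulVec (tokD x y t s u w v e) =
      Pi.single (idxE d K 0) (c * w k) + Pi.single (idxE d K 1) (c * v k) := by
  simp only [forwardValue, Matrix.add_mulVec, single_mulVec_eq_piSingle, tokD_idxW, tokD_idxV]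

/-- One attention block computes two networks with a sum-of-ReLUs activation. -/
lemma attn_forward {N d K M : ℕ} (a b c : Fin M → ℝ) (x : Fin (N + 1) → Fin d → ℝ)
    (y t s : Fin (N + 1) → ℝ) (u : Fin K → Fin d → ℝ) (w v : Fin K → ℝ) :
    attn (M := K * M)
        (fun h => forwardQuery d K (a (finProdFinEquiv.symm h).2) (b (finProdFinEquiv.symm h).2))
        (fun h => forwardKey d K (finProdFinEquiv.symm h).1)
        (fun h => forwardValue d K (finProdFinEquiv.symm h).1 (c (finProdFinEquiv.symm h).2))
        (fun i => tokD (x i) (y i) (t i) (s i) u w v 0) =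
      fun i => tokD (x i) (y i) (t i) (s i) u w v
        ![net (fun t => ∑ m, c m * relu (a m * t + b m)) u w (x i),
          net (fun t => ∑ m, c m * relu (a m * t + b m)) u v (x i), 0, 0] := by
  funext i
  have hN : ((N : ℝ) + 1) ≠ 0 := by positivity
  have single_sum : ∀ (q : Fin (d + 4 + K * d + K + K + 4)) (f : Fin K → ℝ),
      ∑ k, ∑ m, relu (a m * (u k ⬝ᵥ x i) + b m) •
          (Pi.single q (c m * f k) : Fin (d + 4 + K * d + K + K + 4) → ℝ) =
        Pi.single q (net (fun t => ∑ m, c m * relu (a m * t + b m)) u f (x i)) := by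
    intro q f
    funext q'
    by_cases hq : q' = q
    · subst hq
      simp only [Finset.sum_apply, Pi.smul_apply, Pi.single_eq_same, smul_eq_mul, net,
        Finset.mul_sum]
      exact Finset.sum_congr rfl fun k _ => Finset.sum_congr rfl fun m _ => by ring
    · simp [Finset.sum_apply, hq]
  simp only [attn, forwardQuery_dotProduct_forwardKey, forwardValue_mulVec, Finset.sum_const,
    Finset.card_univ, Fintype.card_fin]
  rw [← Equiv.sum_comp finProdFinEquiv]
  simp only [Equiv.symm_apply_apply, Fintype.sum_prod_type, smul_add, Finset.sum_add_distrib]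
  simp only [← smul_add, single_sum]
  rw [← Nat.cast_smul_eq_nsmul ℝ, smul_smul, Nat.cast_add, Nat.cast_one, inv_mul_cancel₀ hN,
    one_smul, tokD_zero_add_single]

lemma abs_dotProduct_le_l2norm {k : ℕ} (f g : Fin k → ℝ) :
    |f ⬝ᵥ g| ≤ l2norm f * l2norm g := by
  refine abs_le_of_sq_le_sq ?_ (mul_nonneg (Real.sqrt_nonneg _) (Real.sqrt_nonneg _))
  rw [l2norm, l2norm, mul_pow, Real.sq_sqrt (Finset.sum_nonneg fun _ _ => sq_nonneg _),
    Real.sq_sqrt (Finset.sum_nonneg fun _ _ => sq_nonneg _)]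
  exact Finset.sum_mul_sq_le_sq_mul_sq _ _ _

lemma sum_abs_le_sqrt_mul_l2norm {k : ℕ} (f : Fin k → ℝ) :
    ∑ i, |f i| ≤ Real.sqrt k * l2norm f := by
  rw [l2norm, ← Real.sqrt_mul (Nat.cast_nonneg k)]
  refine Real.le_sqrt_of_sq_le ?_
  simpa using sq_sum_le_card_mul_sum_sq (s := Finset.univ) (f := fun i => |f i|)

/-- Uniform approximation of the activation controls the error of the network output. -/
lemma abs_net_sub_net_le {K d : ℕ} {r r' : ℝ → ℝ} {R ε : ℝ}
    (h : ∀ t, |t| ≤ R → |r t - r' t| ≤ ε) (u : Fin K → Fin d → ℝ) (w : Fin K → ℝ)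
    (x : Fin d → ℝ) (hR : ∀ k, |u k ⬝ᵥ x| ≤ R) :
    |net r' u w x - net r u w x| ≤ (∑ k, |w k|) * ε := by
  rw [net, net, ← Finset.sum_sub_distrib, Finset.sum_mul]
  refine (Finset.abs_sum_le_sum_abs _ _).trans (Finset.sum_le_sum fun k _ => ?_)
  rw [← mul_sub, abs_mul, abs_sub_comm]
  exact mul_le_mul_of_nonneg_left (h _ (hR k)) (abs_nonneg _)

/-- **Forward-pass approximation by one attention block** (Step 1 of the DANN construction).
Given a sum-of-ReLUs approximant `r̄(t) = Σ_m c_m σ(a_m t + b_m)` of the activation `r` on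
`[−R₁, R₁]` with `R₁ ≥ B_u B_x`, there is an attention block with `K·M₁` heads mapping
`[zᵢ, u, w, v, 0₄]` to `[zᵢ, u, w, v, Λ̄(xᵢ), Δ̄(xᵢ), 0, 0]`, where `Λ̄(x) = Σ_k w_k r̄(u_k⊤x)`
and `Δ̄(x) = Σ_k v_k r̄(u_k⊤x)`; consequently `|Λ̄(xᵢ) − Λ(xᵢ; u, w)| ≤ ‖w‖₁ ε_r ≤ √K B_w ε_r`
and `|Δ̄(xᵢ) − Δ(xᵢ; u, v)| ≤ ‖v‖₁ ε_r ≤ √K B_v ε_r` for all `i`. -/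
theorem attention_approximates_forward_pass
    (n n' d K : ℕ) (hn : 0 < n) (hn' : 0 < n')
    (B_u B_w B_v B_x : ℝ) (hBu : 0 < B_u) (hBw : 0 < B_w) (hBv : 0 < B_v) (hBx : 0 < B_x)
    (εr R₁ : ℝ) (hεr : 0 < εr) (hR₁ : B_u * B_x ≤ R₁)
    (r : ℝ → ℝ) (M₁ : ℕ) (C₁ : ℝ)
    (a b c : Fin M₁ → ℝ)
    (hc : (∑ m, |c m|) ≤ C₁) (hab : ∀ m, |a m| + |b m| ≤ 1)
    (happrox : ∀ t : ℝ, |t| ≤ R₁ → |r t - ∑ m, c m * relu (a m * t + b m)| ≤ εr) :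
    ∃ Q K' V : Fin (K * M₁) →
        Matrix (Fin (d + 4 + K * d + K + K + 4)) (Fin (d + 4 + K * d + K + K + 4)) ℝ,
      ∀ (x : Fin (n + n' + 1) → Fin d → ℝ) (y : Fin (n + n' + 1) → ℝ),
        (∀ i, l2norm (x i) ≤ B_x) →
        ∀ (u : Fin K → Fin d → ℝ) (w v : Fin K → ℝ), memW B_w B_v B_u w v u →
          (attn Q K' V fun i =>
              tokD (x i) (y i) (if (i : ℕ) < n then 1 else 0)
                (if (i : ℕ) < n + n' then 1 else 0) u w v 0) =
            (fun i =>
              tokD (x i) (y i) (if (i : ℕ) < n then 1 else 0)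
                (if (i : ℕ) < n + n' then 1 else 0) u w v
                ![net (fun t => ∑ m, c m * relu (a m * t + b m)) u w (x i),
                  net (fun t => ∑ m, c m * relu (a m * t + b m)) u v (x i), 0, 0]) ∧
          (∀ i : Fin (n + n' + 1),
            |net (fun t => ∑ m, c m * relu (a m * t + b m)) u w (x i) - net r u w (x i)| ≤
              (∑ k, |w k|) * εr) ∧
          ((∑ k, |w k|) * εr ≤ Real.sqrt K * B_w * εr) ∧
          (∀ i : Fin (n + n' + 1),
            |net (fun t => ∑ m, c m * relu (a m * t + b m)) u v (x i) - net r u v (x i)| ≤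
              (∑ k, |v k|) * εr) ∧
          ((∑ k, |v k|) * εr ≤ Real.sqrt K * B_v * εr) := by
  refine ⟨_, _, _, fun x y hx u w v hW => ⟨attn_forward a b c x y _ _ u w v, ?_⟩⟩
  obtain ⟨hw, hv, hu⟩ := hW
  have hux : ∀ i k, |u k ⬝ᵥ x i| ≤ R₁ := fun i k =>
    (abs_dotProduct_le_l2norm _ _).trans
      ((mul_le_mul (hu k) (hx i) (Real.sqrt_nonneg _) hBu.le).trans hR₁)
  have l1_bound : ∀ (f : Fin K → ℝ) (B : ℝ), l2norm f ≤ B →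
      (∑ k, |f k|) * εr ≤ Real.sqrt K * B * εr := fun f B hf =>
    mul_le_mul_of_nonneg_right ((sum_abs_le_sqrt_mul_l2norm f).trans
      (mul_le_mul_of_nonneg_left hf (Real.sqrt_nonneg _))) hεr.le
  exact ⟨fun i => abs_net_sub_net_le happrox u w (x i) (hux i), l1_bound w B_w hw,
    fun i => abs_net_sub_net_le happrox u v (x i) (hux i), l1_bound v B_v hv⟩
end
end

section
/- Fix ε > 0 and R₂ ≥ 1, and let g: ℝ² → ℝ be (ε, R₂, M₂, C₂)-approximable by sum of ReLUs. Then there exists an MLP block (with hidden width at most 3M₂) such that, for every token sequence h′_i = [z_i, u, w, v, Λ̃_i, Δ̃_i, 0, 0], i = 1,…,N+1, with |Λ̃_i| ≤ R₂, |Δ̃_i| ≤ R₂ and |y_i| ≤ R₂ for all i, the block outputs h″_i = [z_i, u, w, v, Λ̃_i, Δ̃_i, g_{Λ,i}, g_{Δ,i}] where |g_{Λ,i} − 𝟙(i ≤ n)·g(Λ̃_i, y_i)| ≤ ε and |g_{Δ,i} − (𝟙(i ≤ n)·g(Δ̃_i, 0) + 𝟙(n < i ≤ N)·g(Δ̃_i,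 1))| ≤ ε for all i; in particular, taking g = ∂₁γ for the sigmoid cross entropy, the block computes source-masked label-loss derivatives and domain-masked domain-loss derivatives up to error ε. -/
open Matrix Finset

noncomputable section

/-- `g : ℝᵏ → ℝ` is `(ε, R, M, C)`-approximable by sum of ReLUs. -/
def ApproxSumReLU {k : ℕ} (g : (Fin k → ℝ) → ℝ) (ε R : ℝ) (M : ℕ) (C : ℝ) : Prop :=
  ∃ (a : Fin M → Fin k → ℝ) (b c : Fin M → ℝ),
    (∑ m, |c m|) ≤ C ∧ (∀ m, (∑ i, |a m i|) + |b m| ≤ 1) ∧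
    ∀ z : Fin k → ℝ, (∀ i, |z i| ≤ R) →
      |g z - ∑ m, c m * relu (a m ⬝ᵥ z + b m)| ≤ ε

/-- The ReLU sum `Σ_m c_m σ(a_m⊤z + b_m − R(1 − μ))`: for `μ = 1` it is the plain ReLU sum, and
for `μ = 0` the offset `R` switches all units off. -/
def maskedReluSum {k M : ℕ} (a : Fin M → Fin k → ℝ) (b c : Fin M → ℝ) (R μ : ℝ)
    (z : Fin k → ℝ) : ℝ :=
  ∑ m, c m * relu (a m ⬝ᵥ z + b m - R * (1 - μ))

lemma maskedReluSum_one {k M : ℕ} (a : Fin M → Fin k → ℝ) (b c : Fin M → ℝ) (R : ℝ)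
    (z : Fin k → ℝ) :
    maskedReluSum a b c R 1 z = ∑ m, c m * relu (a m ⬝ᵥ z + b m) := by
  simp [maskedReluSum]

lemma dotProduct_add_le_of_sum_abs_le_one {k : ℕ} {a z : Fin k → ℝ} {b R : ℝ} (hR : 1 ≤ R)
    (hab : (∑ i, |a i|) + |b| ≤ 1) (hz : ∀ i, |z i| ≤ R) : a ⬝ᵥ z + b ≤ R := by
  have hdot : a ⬝ᵥ z ≤ (∑ i, |a i|) * R := by
    rw [dotProduct, Finset.sum_mul]
    refine Finset.sum_le_sum fun i _ => (le_abs_self _).trans ?_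
    rw [abs_mul]
    exact mul_le_mul_of_nonneg_left (hz i) (abs_nonneg _)
  have hb : |b| ≤ |b| * R := le_mul_of_one_le_right (abs_nonneg _) hR
  nlinarith [le_abs_self b]

lemma maskedReluSum_zero {k M : ℕ} {a : Fin M → Fin k → ℝ} {b : Fin M → ℝ} (c : Fin M → ℝ)
    {R : ℝ} {z : Fin k → ℝ} (hR : 1 ≤ R) (hab : ∀ m, (∑ i, |a m i|) + |b m| ≤ 1)
    (hz : ∀ i, |z i| ≤ R) : maskedReluSum a b c R 0 z = 0 := by
  refine Finset.sum_eq_zero fun m _ => ?_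
  have h := dotProduct_add_le_of_sum_abs_le_one hR (hab m) hz
  rw [relu, max_eq_right (by linarith), mul_zero]

/-- The linear functional on tokens reading `y, t, s, 1` with weights `p` and the scratch block
with weights `q`. -/
def tokFunctional (d K : ℕ) (p q : Fin 4 → ℝ) : Fin (d + 4 + K * d + K + K + 4) → ℝ :=
  Fin.append (Fin.append (Fin.append (Fin.append (Fin.append 0 p) 0) 0) 0) q

lemma dotProduct_append {R : Type*} [NonUnitalNonAssocSemiring R] {m n : ℕ}
    (a a' : Fin m → R) (b b' : Fin n → R) :
    Fin.append a b ⬝ᵥ Fin.append a' b' = a ⬝ᵥ a' + b ⬝ᵥ b' := by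
  simp [dotProduct, Fin.sum_univ_add]

lemma tokFunctional_dotProduct_tokD {d K : ℕ} (p q : Fin 4 → ℝ) (x : Fin d → ℝ) (y t s : ℝ)
    (u : Fin K → Fin d → ℝ) (w v : Fin K → ℝ) (e : Fin 4 → ℝ) :
    tokFunctional d K p q ⬝ᵥ tokD x y t s u w v e = p ⬝ᵥ ![y, t, s, 1] + q ⬝ᵥ e := by
  simp [tokFunctional, tokD, dotProduct_append]

lemma tokD_add_append_zero {d K : ℕ} (x : Fin d → ℝ) (y t s : ℝ) (u : Fin K → Fin d → ℝ)
    (w v : Fin K → ℝ) (e f : Fin 4 → ℝ) :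
    tokD x y t s u w v e + Fin.append 0 f = tokD x y t s u w v (e + f) := by
  ext j
  refine Fin.addCases (fun j => ?_) (fun j => ?_) j <;> simp [tokD]

/-- An MLP block that writes only to the scratch coordinates. -/
lemma mlp_write_scratch {d K : ℕ} {ι : Type*} [Fintype ι] {D' : ℕ} (e : ι ≃ Fin D')
    (p q r : ι → Fin 4 → ℝ) (x : Fin d → ℝ) (y t s : ℝ) (u : Fin K → Fin d → ℝ)
    (w v : Fin K → ℝ) (f : Fin 4 → ℝ) :
    mlp (Matrix.of fun k => tokFunctional d K (p (e.symm k)) (q (e.symm k)))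
        (Matrix.of fun j k => Fin.append 0 (r (e.symm k)) j) (tokD x y t s u w v f) =
      tokD x y t s u w v
        (f + ∑ k, relu (p k ⬝ᵥ ![y, t, s, 1] + q k ⬝ᵥ f) • r k) := by
  rw [← tokD_add_append_zero, mlp]
  congr 1
  ext j
  simp only [Matrix.mulVec, Matrix.of_apply]
  rw [dotProduct, ← e.sum_comp]
  refine Fin.addCases (fun j => ?_) (fun j => ?_) j
  · simp
  · simp [tokFunctional_dotProduct_tokD, Finset.sum_apply, mul_comm]

/-- **Masked loss-derivative approximation by one MLP block** (Step 2 of the DANN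
construction).  For `g : ℝ² → ℝ` which is `(ε, R₂, M₂, C₂)`-approximable by sum of ReLUs,
there is an MLP block of hidden width at most `3M₂` mapping `[zᵢ, u, w, v, Λ̃ᵢ, Δ̃ᵢ, 0, 0]` to
`[zᵢ, u, w, v, Λ̃ᵢ, Δ̃ᵢ, g_{Λ,i}, g_{Δ,i}]` with
`|g_{Λ,i} − 𝟙(i ≤ n) g(Λ̃ᵢ, yᵢ)| ≤ ε` and
`|g_{Δ,i} − (𝟙(i ≤ n) g(Δ̃ᵢ, 0) + 𝟙(n < i ≤ N) g(Δ̃ᵢ, 1))| ≤ ε` for all `i`. -/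
theorem mlp_approximates_masked_loss_derivatives
    (n n' d K : ℕ) (hn : 0 < n) (hn' : 0 < n')
    (ε R₂ : ℝ) (hε : 0 < ε) (hR₂ : 1 ≤ R₂)
    (M₂ : ℕ) (C₂ : ℝ) (g : (Fin 2 → ℝ) → ℝ)
    (happrox : ApproxSumReLU g ε R₂ M₂ C₂) :
    ∃ (D' : ℕ) (W₁ : Matrix (Fin D') (Fin (d + 4 + K * d + K + K + 4)) ℝ)
        (W₂ : Matrix (Fin (d + 4 + K * d + K + K + 4)) (Fin D') ℝ),
      D' ≤ 3 * M₂ ∧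
      ∀ (x : Fin (n + n' + 1) → Fin d → ℝ) (y : Fin (n + n' + 1) → ℝ)
        (u : Fin K → Fin d → ℝ) (w v : Fin K → ℝ) (Λt Δt : Fin (n + n' + 1) → ℝ),
        (∀ i, |Λt i| ≤ R₂) → (∀ i, |Δt i| ≤ R₂) → (∀ i, |y i| ≤ R₂) →
        ∃ gΛ gΔ : Fin (n + n' + 1) → ℝ,
          (∀ i, mlp W₁ W₂
              (tokD (x i) (y i) (if (i : ℕ) < n then 1 else 0)
                (if (i : ℕ) < n + n' then 1 else 0) u w v ![Λt i, Δt i, 0, 0]) =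
            tokD (x i) (y i) (if (i : ℕ) < n then 1 else 0)
              (if (i : ℕ) < n + n' then 1 else 0) u w v ![Λt i, Δt i, gΛ i, gΔ i]) ∧
          (∀ i : Fin (n + n' + 1),
            |gΛ i - (if (i : ℕ) < n then g ![Λt i, y i] else 0)| ≤ ε) ∧
          (∀ i : Fin (n + n' + 1),
            |gΔ i - ((if (i : ℕ) < n then g ![Δt i, 0] else 0)
              + (if n ≤ (i : ℕ) ∧ (i : ℕ) < n + n' then g ![Δt i, 1] else 0))| ≤ ε) := by
  obtain ⟨a, b, c, -, hab, hg⟩ := happrox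
  let p : Fin 3 × Fin M₂ → Fin 4 → ℝ := fun k =>
    ![![a k.2 1, R₂, 0, b k.2 - R₂],
      ![0, R₂, 0, b k.2 - R₂],
      ![0, -R₂, R₂, a k.2 1 + b k.2 - R₂]] k.1
  let q : Fin 3 × Fin M₂ → Fin 4 → ℝ := fun k =>
    ![![a k.2 0, 0, 0, 0], ![0, a k.2 0, 0, 0], ![0, a k.2 0, 0, 0]] k.1
  let r : Fin 3 × Fin M₂ → Fin 4 → ℝ := fun k =>
    ![![0, 0, c k.2, 0], ![0, 0, 0, c k.2], ![0, 0, 0, c k.2]] k.1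
  let e : Fin 3 × Fin M₂ ≃ Fin (3 * M₂) := finProdFinEquiv
  refine ⟨3 * M₂,
    Matrix.of fun k => tokFunctional d K (p (e.symm k)) (q (e.symm k)),
    Matrix.of fun j k => Fin.append 0 (r (e.symm k)) j, le_rfl, ?_⟩
  intro x y u w v Λt Δt hΛ hΔ hy
  let t : Fin (n + n' + 1) → ℝ := fun i => if (i : ℕ) < n then 1 else 0
  let s : Fin (n + n' + 1) → ℝ := fun i => if (i : ℕ) < n + n' then 1 else 0
  have hbox {α β : ℝ} (hα : |α| ≤ R₂) (hβ : |β| ≤ R₂) : ∀ j, |![α, β] j| ≤ R₂ :=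
    Fin.forall_fin_two.2 ⟨hα, hβ⟩
  have hzero : |(0 : ℝ)| ≤ R₂ := by rw [abs_zero]; linarith
  have hone : |(1 : ℝ)| ≤ R₂ := by rwa [abs_one]
  have hoff {z : Fin 2 → ℝ} (hz : ∀ j, |z j| ≤ R₂) : maskedReluSum a b c R₂ 0 z = 0 :=
    maskedReluSum_zero c hR₂ hab hz
  have hon {z : Fin 2 → ℝ} (hz : ∀ j, |z j| ≤ R₂) : |maskedReluSum a b c R₂ 1 z - g z| ≤ ε := by
    rw [maskedReluSum_one, abs_sub_comm]
    exact hg z hz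
  refine ⟨fun i => maskedReluSum a b c R₂ (t i) ![Λt i, y i],
    fun i => maskedReluSum a b c R₂ (t i) ![Δt i, 0] +
      maskedReluSum a b c R₂ (s i - t i) ![Δt i, 1], fun i => ?_, fun i => ?_, fun i => ?_⟩
  · rw [mlp_write_scratch]
    congr 1
    change _ + ∑ k, relu (p k ⬝ᵥ ![y i, t i, s i, 1] + _) • r k = _
    rw [Fintype.sum_prod_type, Fin.sum_univ_three]
    ext j
    fin_cases j <;>
      simp [p, q, r, maskedReluSum, Finset.sum_apply, dotProduct, Fin.sum_univ_succ]
    · refine Finset.sum_congr rfl fun m _ => ?_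
      rw [mul_comm]
      congr 2
      ring
    · congr 1 <;>
      · refine Finset.sum_congr rfl fun m _ => ?_
        rw [mul_comm]
        congr 2
        ring
  · by_cases hi : (i : ℕ) < n
    · simpa [t, hi] using hon (hbox (hΛ i) (hy i))
    · simpa [t, hi, hoff (hbox (hΛ i) (hy i))] using hε.le
  · have h0 := hbox (hΔ i) hzero
    have h1 := hbox (hΔ i) hone
    by_cases hi : (i : ℕ) < n
    · have hi' : (i : ℕ) < n + n' := by omega
      simpa [t, s, hi, hi', not_le.2 hi, hoff h1] using hon h0
    · by_cases hi' : (i : ℕ) < n + n'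
      · simpa [t, s, hi, hi', not_lt.1 hi, hoff h0] using hon h1
      · simpa [t, s, hi, hi', hoff h0, hoff h1] using hε.le
end
end

section
/- Fix B_x ≥ 1 and ε > 0, and let K: ℝ^d × ℝ^d → ℝ be a kernel that, viewed as a function on ℝ^{2d}, is (ε, B_x, M₁, C₁)-approximable by sum of ReLUs. Then there exists an attention block with M₁ heads such that, for every input with ‖x_i‖_∞ ≤ B_x for all i = 1,…,N+1, it maps tokens whose first d+4 coordinates are z_i = [x_i, y_i, t_i, s_i, 1] (with zeros in a designated free coordinate) to tokens that are unchanged except that the designated coordinate of the i-th token equals p_i, where |p_i − p̂_S(x_i)| ≤ ε for all i = 1,…,N+1, and p̂_S(x) = (1/n) Σ_{j=1}^n K(x, x_j) is the kernel density estimate built from the source inputs. -/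
open Matrix Finset

noncomputable section

/-- Averaging a function over the first `n` indices perturbs by at most `ε` when each term does. -/
theorem abs_mean_sub_mean_le {n N : ℕ} (hn : 0 < n) (hnN : n ≤ N) {ε : ℝ} (f g : Fin N → ℝ)
    (hfg : ∀ j, |f j - g j| ≤ ε) :
    |(n : ℝ)⁻¹ * (∑ j : Fin N, if (j : ℕ) < n then f j else 0) -
      (n : ℝ)⁻¹ * ∑ j : Fin N, if (j : ℕ) < n then g j else 0| ≤ ε := by
  have hn0 : (0 : ℝ) < n := by exact_mod_cast hn
  have hcard : #{j : Fin N | (j : ℕ) < n} = n := by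
    simp [Fin.card_filter_val_lt, hnN]
  rw [← mul_sub, ← Finset.sum_filter, ← Finset.sum_filter, ← Finset.sum_sub_distrib, abs_mul,
    abs_of_pos (inv_pos.2 hn0), inv_mul_le_iff₀ hn0]
  refine (Finset.abs_sum_le_sum_abs _ _).trans ?_
  refine (Finset.sum_le_card_nsmul _ _ ε fun j _ => hfg j).trans ?_
  rw [hcard, nsmul_eq_mul]

/-- If the heads compute the ReLU of a score `s m i j` and write `w m j` into
coordinate `e`, then the attention block changes only coordinate `e`. -/
theorem attn_eq_of_value_single {D M N : ℕ} {Q K V : Fin M → Matrix (Fin D) (Fin D) ℝ}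
    {h : Fin (N + 1) → Fin D → ℝ} (e : Fin D) (s : Fin M → Fin (N + 1) → Fin (N + 1) → ℝ)
    (w : Fin M → Fin (N + 1) → ℝ)
    (hs : ∀ m i j, (Q m).mulVec (h i) ⬝ᵥ (K m).mulVec (h j) = s m i j)
    (hw : ∀ m j, (V m).mulVec (h j) = Pi.single e (w m j)) (he : ∀ i, h i e = 0) :
    attn Q K V h = fun i k =>
      if k = e then ((N : ℝ) + 1)⁻¹ * ∑ j, ∑ m, relu (s m i j) * w m j else h i k := by
  funext i k
  simp only [attn, hs, hw, Pi.add_apply, Pi.smul_apply, Finset.sum_apply, smul_eq_mul]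
  split_ifs with hk
  · subst hk
    simp [he]
  · simp [hk]

/-- **Kernel density estimation by one attention block** (Step 1 of the algorithm-selection
construction).  If the kernel `K`, viewed on `ℝ^{2d}`, is `(ε, B_x, M₁, C₁)`-approximable by
sum of ReLUs, there is an `M₁`-head attention block that writes, into a designated free
coordinate of each token, a value `pᵢ` with `|pᵢ − p̂_S(xᵢ)| ≤ ε`, where
`p̂_S(x) = (1/n) Σ_{j≤n} K(x, xⱼ)` is the source kernel density estimate. -/
theorem attention_approximates_kernel_density_estimate
    (n n' d p : ℕ) (hn : 0 < n) (hn' : 0 < n')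
    (B_x ε : ℝ) (hBx : 1 ≤ B_x) (hε : 0 < ε)
    (Kker : (Fin d → ℝ) → (Fin d → ℝ) → ℝ) (M₁ : ℕ) (C₁ : ℝ)
    (happrox : ApproxSumReLU (fun z : Fin (d + d) → ℝ =>
      Kker (fun j => z (Fin.castAdd d j)) (fun j => z (Fin.natAdd d j))) ε B_x M₁ C₁) :
    ∃ Q K V : Fin M₁ → Matrix (Fin (d + 4 + 1 + p)) (Fin (d + 4 + 1 + p)) ℝ,
      ∀ (x : Fin (n + n' + 1) → Fin d → ℝ) (y : Fin (n + n' + 1) → ℝ),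
        (∀ i j, |x i j| ≤ B_x) →
        ∀ h : Fin (n + n' + 1) → Fin (d + 4 + 1 + p) → ℝ,
          -- the first `d+4` coordinates of the `i`-th token are `zᵢ = [xᵢ, yᵢ, tᵢ, sᵢ, 1]`
          (∀ i, ∀ k : Fin (d + 4),
            h i (Fin.castLE (show d + 4 ≤ d + 4 + 1 + p by omega) k) =
              Fin.append (x i)
                ![y i, if (i : ℕ) < n then 1 else 0, if (i : ℕ) < n + n' then 1 else 0, 1] k) →
          -- the designated free coordinate is zero
          (∀ i, h i ⟨d + 4, by omega⟩ = 0) →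
          ∃ pv : Fin (n + n' + 1) → ℝ,
            (∀ i, |pv i - (n : ℝ)⁻¹ *
              ∑ j : Fin (n + n' + 1), if (j : ℕ) < n then Kker (x i) (x j) else 0| ≤ ε) ∧
            attn Q K V h = fun i k =>
              if k = (⟨d + 4, by omega⟩ : Fin (d + 4 + 1 + p)) then pv i else h i k := by
  obtain ⟨a, b, c, -, -, hK⟩ := happrox
  have hN0 : ((n + n' : ℕ) : ℝ) + 1 ≠ 0 := by positivity
  let ι : Fin (d + 4) → Fin (d + 4 + 1 + p) := Fin.castLE (by omega)
  let e : Fin (d + 4 + 1 + p) := ⟨d + 4, by omega⟩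
  let one : Fin (d + 4 + 1 + p) := ι (Fin.natAdd d 3)
  let α (m : Fin M₁) : Fin (d + 4 + 1 + p) → ℝ :=
    ∑ j : Fin d, Pi.single (ι (Fin.castAdd 4 j)) (a m (Fin.castAdd d j))
  let β (m : Fin M₁) : Fin (d + 4 + 1 + p) → ℝ :=
    ∑ j : Fin d, Pi.single (ι (Fin.castAdd 4 j)) (a m (Fin.natAdd d j)) + Pi.single one (b m)
  refine ⟨fun m => vecMulVec (Pi.single one 1) (α m) + vecMulVec (β m) (Pi.single one 1),
    fun _ => 1, fun m => vecMulVec (Pi.single e ((((n + n' : ℕ) : ℝ) + 1) * (n : ℝ)⁻¹ * c m))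
      (Pi.single (ι (Fin.natAdd d 1)) 1), fun x y hx h hz he => ?_⟩
  have hιx (i) (j : Fin d) : h i (ι (Fin.castAdd 4 j)) = x i j := by simp [ι, hz]
  have hone (i) : h i one = 1 := by simp [one, ι, hz]
  have ht (i) : h i (ι (Fin.natAdd d 1)) = if (i : ℕ) < n then 1 else 0 := by simp [ι, hz]
  let S (i j : Fin (n + n' + 1)) : ℝ :=
    ∑ m, c m * relu (a m ⬝ᵥ Fin.append (x i) (x j) + b m)
  have hS (i j) : |S i j - Kker (x i) (x j)| ≤ ε := by
    rw [abs_sub_comm]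
    have := hK (Fin.append (x i) (x j)) fun k => by
      induction k using Fin.addCases <;> simp [hx, -Fin.natAdd_eq_addNat]
    simpa [-Fin.natAdd_eq_addNat] using this
  refine ⟨fun i => (n : ℝ)⁻¹ * ∑ j : Fin (n + n' + 1), if (j : ℕ) < n then S i j else 0,
    fun i => abs_mean_sub_mean_le hn (by omega) _ _ (hS i), ?_⟩
  rw [attn_eq_of_value_single e
    (fun m i j => a m ⬝ᵥ Fin.append (x i) (x j) + b m)
    (fun m j => (((n + n' : ℕ) : ℝ) + 1) * (n : ℝ)⁻¹ * c m * if (j : ℕ) < n then 1 else 0)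
    ?_ ?_ he]
  · funext i k
    congr 1
    rw [inv_mul_eq_iff_eq_mul₀ hN0, ← mul_assoc, Finset.mul_sum]
    refine Finset.sum_congr rfl fun j _ => ?_
    split_ifs
    · rw [Finset.mul_sum]
      exact Finset.sum_congr rfl fun m _ => by ring
    · simp
  · intro m i j
    simp only [add_mulVec, vecMulVec_mulVec, one_mulVec, add_dotProduct, α, β, sum_dotProduct,
      single_dotProduct, op_smul_eq_smul, smul_dotProduct, hone, hιx, one_mul, smul_eq_mul, mul_one]
    simp [dotProduct, Fin.sum_univ_add, add_assoc, -Fin.natAdd_eq_addNat]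
  · intro m j
    rw [vecMulVec_mulVec, single_dotProduct, ht, one_mul, op_smul_eq_smul, ← Pi.single_smul,
      smul_eq_mul, mul_comm]
end
end
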